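/- For non-zero natural numbers k and t: k divides t if and only if {ω·k, ω*·k} ≤_c {ω·t, ω*·t}. -/

import Mathlib

/-- A finite linear order: a finite piece of an atomic diagram in the language `{<}`,
with domain a finite set of naturals. -/
structure FinLO where
  dom : Finset ℕ
  rel : ℕ → ℕ → Prop
  irrefl : ∀ x ∈ dom, ¬ rel x x
  trans : ∀ x ∈ dom, ∀ y ∈ dom, ∀ z ∈ dom, rel x y → rel y z → rel x z
  total : ∀ x ∈ dom, ∀ y ∈ dom, x ≠ y → rel x y ∨ rel y x

/-- `β` extends `α` as a finite atomic diagram. -/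
def FinLO.Ext (α β : FinLO) : Prop :=
  α.dom ⊆ β.dom ∧ ∀ x ∈ α.dom, ∀ y ∈ α.dom, (α.rel x y ↔ β.rel x y)

/-- An enumeration operator on finite linear orders: it monotonically enumerates
membership facts `x ∈ Γ(α)`, positive atomic facts `x < y` and negative atomic
facts `¬ x < y`. -/
structure EnumOp where
  mem : FinLO → Set ℕ
  pos : FinLO → Set (ℕ × ℕ)
  neg : FinLO → Set (ℕ × ℕ)
  mono_mem : ∀ {α β : FinLO}, α.Ext β → mem α ⊆ mem β
  mono_pos : ∀ {α β : FinLO}, α.Ext β → pos α ⊆ pos β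
  mono_neg : ∀ {α β : FinLO}, α.Ext β → neg α ⊆ neg β

/-- The outputs of `Γ` are consistent with being part of the atomic diagram of
a linear order. -/
def EnumOp.Consistent (Γ : EnumOp) : Prop :=
  ∀ α : FinLO, (∀ x : ℕ, (x, x) ∉ Γ.pos α) ∧
    (∀ x y : ℕ, ¬ ((x, y) ∈ Γ.pos α ∧ (y, x) ∈ Γ.pos α)) ∧
    (∀ x y : ℕ, ¬ ((x, y) ∈ Γ.pos α ∧ (x, y) ∈ Γ.neg α))

/-- `α ⊩_Γ x < y` : both `x` and `y` occur in `Γ(α)` and no extension `β ⊇ α`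
has `Γ(β) ⊨ ¬ (x < y)`. -/
def EnumOp.Forces (Γ : EnumOp) (α : FinLO) (x y : ℕ) : Prop :=
  x ∈ Γ.mem α ∧ y ∈ Γ.mem α ∧ ∀ β : FinLO, α.Ext β → (x, y) ∉ Γ.neg β

/-- Every pair of distinct elements occurring in `Γ(α)` is decided by some
extension of `α`. -/
def EnumOp.Decides (Γ : EnumOp) : Prop :=
  ∀ α : FinLO, ∀ x ∈ Γ.mem α, ∀ y ∈ Γ.mem α, x ≠ y →
    ∃ β : FinLO, α.Ext β ∧ ((x, y) ∈ Γ.pos β ∨ (x, y) ∈ Γ.neg β)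

/-- A (possibly infinite) diagram in the language `{<}` with domain a set of naturals. -/
structure LinDiag where
  dom : Set ℕ
  rel : ℕ → ℕ → Prop

/-- `α` is a finite subdiagram of `L`. -/
def FinLO.SubDiag (α : FinLO) (L : LinDiag) : Prop :=
  ↑α.dom ⊆ L.dom ∧ ∀ x ∈ α.dom, ∀ y ∈ α.dom, (α.rel x y ↔ L.rel x y)

/-- Membership facts enumerated by `Γ` on the infinite diagram `L`. -/
def EnumOp.memD (Γ : EnumOp) (L : LinDiag) : Set ℕ :=
  {x | ∃ α : FinLO, α.SubDiag L ∧ x ∈ Γ.mem α}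

/-- Positive facts `x < y` enumerated by `Γ` on the infinite diagram `L`. -/
def EnumOp.posD (Γ : EnumOp) (L : LinDiag) : Set (ℕ × ℕ) :=
  {p | ∃ α : FinLO, α.SubDiag L ∧ p ∈ Γ.pos α}

/-- Negative facts `¬ x < y` enumerated by `Γ` on the infinite diagram `L`. -/
def EnumOp.negD (Γ : EnumOp) (L : LinDiag) : Set (ℕ × ℕ) :=
  {p | ∃ α : FinLO, α.SubDiag L ∧ p ∈ Γ.neg α}

/-- `L` is (the atomic diagram of) a copy of the linear order `τ`. -/
def IsCopy (τ : Type) [LinearOrder τ] (L : LinDiag) : Prop :=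
  ∃ f : τ → ℕ, Function.Injective f ∧ Set.range f = L.dom ∧
    ∀ i j : τ, (L.rel (f i) (f j) ↔ i < j)

/-- The output of `Γ` on `L` is (the atomic diagram of) a copy of the linear
order `σ`. -/
def EnumOp.OutCopy (Γ : EnumOp) (σ : Type) [LinearOrder σ] (L : LinDiag) : Prop :=
  ∃ g : σ → ℕ, Function.Injective g ∧ Γ.memD L = Set.range g ∧
    (∀ a b : σ, ((g a, g b) ∈ Γ.posD L ↔ a < b)) ∧
    (∀ a b : σ, ((g a, g b) ∈ Γ.negD L ↔ ¬ a < b))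

/-- `Γ` is a computable embedding of the pair `{A, B}` into the pair `{C, D}`:
it maps every copy of `A` to a copy of `C` and every copy of `B` to a copy of `D`. -/
def EnumOp.Embeds (Γ : EnumOp) (A B C D : Type) [LinearOrder A] [LinearOrder B]
    [LinearOrder C] [LinearOrder D] : Prop :=
  (∀ L : LinDiag, IsCopy A L → Γ.OutCopy C L) ∧
  (∀ L : LinDiag, IsCopy B L → Γ.OutCopy D L)

/-- `{A, B} ≤_c {C, D}` : there is a computable embedding (an enumeration
operator) of the pair `{A, B}` into the pair `{C, D}`. -/
def PairLE (A B C D : Type) [LinearOrder A] [LinearOrder B] [LinearOrder C]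
    [LinearOrder D] : Prop :=
  ∃ Γ : EnumOp, Γ.Embeds A B C D

/-! ### Linear diagrams, their restrictions and copies of `ω·k` -/

/-- The relation of `L` is a strict linear order on its domain. -/
structure LinDiag.IsLin (L : LinDiag) : Prop where
  irrefl : ∀ x ∈ L.dom, ¬ L.rel x x
  trans : ∀ x ∈ L.dom, ∀ y ∈ L.dom, ∀ z ∈ L.dom, L.rel x y → L.rel y z → L.rel x z
  total : ∀ x ∈ L.dom, ∀ y ∈ L.dom, x ≠ y → L.rel x y ∨ L.rel y x

/-- The restriction of a linear diagram to a finite part of its domain. -/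
def LinDiag.restrict (L : LinDiag) (hL : L.IsLin) (D : Finset ℕ) (hD : ↑D ⊆ L.dom) : FinLO where
  dom := D
  rel := L.rel
  irrefl x hx := hL.irrefl x (hD hx)
  trans x hx y hy z hz := hL.trans x (hD hx) y (hD hy) z (hD hz)
  total x hx y hy := hL.total x (hD hx) y (hD hy)

theorem LinDiag.restrict_subDiag {L : LinDiag} (hL : L.IsLin) {D : Finset ℕ} (hD : ↑D ⊆ L.dom) :
    (L.restrict hL D hD).SubDiag L :=
  ⟨hD, fun _ _ _ _ => Iff.rfl⟩

theorem FinLO.SubDiag.ext_restrict {L : LinDiag} (hL : L.IsLin) {D : Finset ℕ} (hD : ↑D ⊆ L.dom)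
    {α : FinLO} (hα : α.SubDiag L) (h : α.dom ⊆ D) : α.Ext (L.restrict hL D hD) :=
  ⟨h, hα.2⟩

theorem FinLO.Ext.trans {α β γ : FinLO} (h : α.Ext β) (h' : β.Ext γ) : α.Ext γ :=
  ⟨h.1.trans h'.1, fun x hx y hy => (h.2 x hx y hy).trans (h'.2 x (h.1 hx) y (h.1 hy))⟩

theorem FinLO.Ext.subDiag {α β : FinLO} {L : LinDiag} (h : α.Ext β) (h' : β.SubDiag L) :
    α.SubDiag L :=
  ⟨fun _ hx => h'.1 (h.1 hx),
    fun x hx y hy => (h.2 x hx y hy).trans (h'.2 x (h.1 hx) y (h.1 hy))⟩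

theorem FinLO.SubDiag.exists_common {L : LinDiag} (hL : L.IsLin) {α β : FinLO}
    (hα : α.SubDiag L) (hβ : β.SubDiag L) : ∃ γ : FinLO, γ.SubDiag L ∧ α.Ext γ ∧ β.Ext γ := by
  have hD : ↑(α.dom ∪ β.dom) ⊆ L.dom := by
    intro x hx
    rcases Finset.mem_union.1 hx with h | h
    exacts [hα.1 h, hβ.1 h]
  exact ⟨L.restrict hL _ hD, L.restrict_subDiag hL hD,
    hα.ext_restrict hL hD Finset.subset_union_left, hβ.ext_restrict hL hD Finset.subset_union_right⟩

theorem IsCopy.isLin {τ : Type} [LinearOrder τ] {L : LinDiag} (h : IsCopy τ L) : L.IsLin := by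
  obtain ⟨f, hf, hr, hlt⟩ := h
  refine ⟨?_, ?_, ?_⟩ <;> rw [← hr]
  · rintro _ ⟨i, rfl⟩
    simp [hlt]
  · rintro _ ⟨i, rfl⟩ _ ⟨j, rfl⟩ _ ⟨l, rfl⟩
    simpa only [hlt] using lt_trans
  · rintro _ ⟨i, rfl⟩ _ ⟨j, rfl⟩ hij
    simpa only [hlt] using lt_or_gt_of_ne fun h => hij (congrArg f h)

/-- The reverse of a diagram. -/
def LinDiag.swap (L : LinDiag) : LinDiag := ⟨L.dom, fun x y => L.rel y x⟩

theorem IsCopy.dual {τ : Type} [LinearOrder τ] {L : LinDiag} (h : IsCopy τ L.swap) :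
    IsCopy τᵒᵈ L := by
  obtain ⟨f, hf, hr, hlt⟩ := h
  exact ⟨f ∘ OrderDual.ofDual, hf.comp OrderDual.ofDual.injective,
    by rw [OrderDual.ofDual.surjective.range_comp]; exact hr,
    fun i j => hlt (OrderDual.ofDual j) (OrderDual.ofDual i)⟩

/-- A linear diagram split into `k` consecutive infinite classes in which every element has
finitely many predecessors is a copy of `ω·k`. -/
theorem isCopy_of_classes {k : ℕ} {L : LinDiag} (hL : L.IsLin) (c : ℕ → ℕ)
    (hck : ∀ x, c x < k) (hc : ∀ x ∈ L.dom, ∀ y ∈ L.dom, c x < c y → L.rel x y)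
    (hfin : ∀ x ∈ L.dom, {y ∈ L.dom | c y = c x ∧ L.rel y x}.Finite)
    (hinf : ∀ i < k, {x ∈ L.dom | c x = i}.Infinite) :
    IsCopy (Lex (Fin k × ℕ)) L := by
  classical
  let r : ℕ → ℕ := fun x => {y ∈ L.dom | c y = c x ∧ L.rel y x}.ncard
  have hr : ∀ x ∈ L.dom, ∀ y ∈ L.dom, c x = c y → L.rel x y → r x < r y := by
    intro x hx y hy hxy h
    refine Set.ncard_lt_ncard ⟨?_, ?_⟩ (hfin y hy)
    · rintro w ⟨hw, hwx, hwr⟩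
      exact ⟨hw, hwx.trans hxy, hL.trans w hw x hx y hy hwr h⟩
    · intro hsub
      exact hL.irrefl x hx (hsub ⟨hx, hxy, h⟩).2.2
  have hrinj : ∀ x ∈ L.dom, ∀ y ∈ L.dom, c x = c y → r x = r y → x = y := by
    intro x hx y hy hxy h
    by_contra hne
    rcases hL.total x hx y hy hne with h' | h'
    · exact (hr x hx y hy hxy h').ne h
    · exact (hr y hy x hx hxy.symm h').ne' h
  have hriff : ∀ x ∈ L.dom, ∀ y ∈ L.dom, c x = c y → (L.rel x y ↔ r x < r y) := by
    refine fun x hx y hy hxy => ⟨hr x hx y hy hxy, fun h => ?_⟩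
    rcases hL.total x hx y hy (by rintro rfl; exact h.false) with h' | h'
    · exact h'
    · exact absurd (hr y hy x hx hxy.symm h') h.asymm
  let p : ℕ → ℕ → Prop := fun i n => ∃ x ∈ L.dom, c x = i ∧ r x = n
  have hp : ∀ i < k, (Set.ofPred (p i)).Infinite := by
    intro i hi
    have : Set.ofPred (p i) = r '' {x ∈ L.dom | c x = i} := by
      ext n
      change p i n ↔ _
      simp [p, and_assoc]
    rw [this]
    refine (hinf i hi).image ?_
    rintro x ⟨hx, hxi⟩ y ⟨hy, hyi⟩ h
    exact hrinj x hx y hy (hxi.trans hyi.symm) h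
  have key : ∀ a : Lex (Fin k × ℕ), p (ofLex a).1 (Nat.nth (p (ofLex a).1) (ofLex a).2) :=
    fun a => Nat.nth_mem_of_infinite (hp _ (ofLex a).1.2) _
  choose f hfd hfc hfr using key
  have hrel : ∀ a b, (L.rel (f a) (f b) ↔ a < b) := by
    intro a b
    rw [Prod.Lex.lt_iff]
    rcases lt_trichotomy (ofLex a).1 (ofLex b).1 with h | h | h
    · simp only [h, true_or, iff_true]
      exact hc _ (hfd a) _ (hfd b) (by rw [hfc, hfc]; exact h)
    · rw [hriff _ (hfd a) _ (hfd b) (by rw [hfc, hfc, h]), hfr, hfr, h,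
        Nat.nth_lt_nth (hp _ (ofLex b).1.2)]
      simp
    · simp only [h.not_gt, h.ne', false_and, or_self, iff_false]
      intro h'
      refine hL.irrefl _ (hfd a) (hL.trans _ (hfd a) _ (hfd b) _ (hfd a) h' ?_)
      exact hc _ (hfd b) _ (hfd a) (by rw [hfc, hfc]; exact h)
  refine ⟨f, ?_, ?_, hrel⟩
  · intro a b hab
    rcases lt_trichotomy a b with h | h | h
    · exact absurd (hab ▸ (hrel a b).2 h) (hL.irrefl _ (hfd b))
    · exact h
    · exact absurd (hab ▸ (hrel b a).2 h) (hL.irrefl _ (hfd b))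
  · ext x
    constructor
    · rintro ⟨a, rfl⟩
      exact hfd a
    · intro hx
      obtain ⟨n, hn⟩ : r x ∈ Set.range (Nat.nth (p (c x))) := by
        rw [Nat.range_nth_of_infinite (hp _ (hck x))]
        exact ⟨x, hx, rfl, rfl⟩
      refine ⟨toLex (⟨c x, hck x⟩, n), hrinj _ (hfd _) x hx ?_ ?_⟩
      · rw [hfc]; rfl
      · rw [hfr]; exact hn

/-! ### Diagrams given by keys -/

/-- Natural numbers compared by the key `G`, ties being broken by the usual order. -/
def keyRel {A : Type} [LinearOrder A] (G : ℕ → A) (x y : ℕ) : Prop :=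
  G x < G y ∨ G x = G y ∧ x < y

theorem keyRel_iff {A : Type} [LinearOrder A] (G : ℕ → A) (x y : ℕ) :
    keyRel G x y ↔ toLex (G x, x) < toLex (G y, y) :=
  (Prod.Lex.toLex_lt_toLex (x := (G x, x)) (y := (G y, y))).symm

/-- The diagram on `S` with the order given by the key `G`. -/
def keyDiag {A : Type} [LinearOrder A] (G : ℕ → A) (S : Set ℕ) : LinDiag := ⟨S, keyRel G⟩

theorem keyDiag_isLin {A : Type} [LinearOrder A] (G : ℕ → A) (S : Set ℕ) :
    (keyDiag G S).IsLin where
  irrefl x _ := by simp [keyDiag, keyRel_iff]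
  trans x _ y _ z _ := by simpa only [keyDiag, keyRel_iff] using lt_trans
  total x _ y _ hxy := by
    simpa only [keyDiag, keyRel_iff] using
      lt_or_gt_of_ne fun h => hxy (congrArg (fun a => (ofLex a).2) h)

/-- The finite linear order on `D` given by the key `G`. -/
def keyFin {A : Type} [LinearOrder A] (G : ℕ → A) (D : Finset ℕ) : FinLO :=
  (keyDiag G D).restrict (keyDiag_isLin G D) D subset_rfl

/-- Two keys order the elements of `D` in the same way. -/
def KeyAgree {A B : Type} [LinearOrder A] [LinearOrder B] (G : ℕ → A) (H : ℕ → B)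
    (D : Finset ℕ) : Prop :=
  ∀ x ∈ D, ∀ y ∈ D, (keyRel G x y ↔ keyRel H x y)

theorem KeyAgree.ext {A B : Type} [LinearOrder A] [LinearOrder B] {G : ℕ → A} {H : ℕ → B}
    {D E : Finset ℕ} (h : KeyAgree G H D) (hDE : D ⊆ E) : (keyFin G D).Ext (keyFin H E) :=
  ⟨hDE, h⟩

theorem KeyAgree.subDiag {A B : Type} [LinearOrder A] [LinearOrder B] {G : ℕ → A} {H : ℕ → B}
    {D : Finset ℕ} {S : Set ℕ} (h : KeyAgree G H D) (hDS : ↑D ⊆ S) :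
    (keyFin G D).SubDiag (keyDiag H S) :=
  ⟨hDS, h⟩

theorem keyDiag_column_isCopy {k : ℕ} (hk : 0 < k) (N : ℕ) :
    IsCopy (Lex (Fin k × ℕ)) (keyDiag (· % k) {x | N ≤ x}) := by
  refine isCopy_of_classes (keyDiag_isLin _ _) (· % k) (fun x => Nat.mod_lt x hk)
    (fun x _ y _ h => Or.inl h) (fun x _ => (Set.finite_lt_nat x).subset ?_) fun i hi => ?_
  · rintro y ⟨_, h, h' | h'⟩
    · exact absurd h h'.ne
    · exact h'.2
  · refine Set.infinite_of_injective_forall_mem (f := fun n => k * (n + N) + i) ?_ fun n => ⟨?_, ?_⟩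
    · intro a b h
      simpa [hk.ne'] using h
    · have : n + N ≤ k * (n + N) := Nat.le_mul_of_pos_left _ hk
      change N ≤ k * (n + N) + i
      omega
    · rw [Nat.mul_add_mod, Nat.mod_eq_of_lt hi]

/-- A finite linear order followed by a copy of `ω·k` on the numbers that are at least `N`. -/
def FinLO.append (β : FinLO) (k N : ℕ) : LinDiag where
  dom := ↑β.dom ∪ {x | N ≤ x}
  rel x y := (x < N ∧ y < N ∧ β.rel x y) ∨ (x < N ∧ N ≤ y) ∨
    (N ≤ x ∧ N ≤ y ∧ keyRel (· % k) x y)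

theorem FinLO.append_isCopy (β : FinLO) {k : ℕ} (hk : 0 < k) (N : ℕ) :
    IsCopy (Lex (Fin k × ℕ)) (β.append k N) := by
  have hlin := keyDiag_isLin (· % k) Set.univ
  have hmem : ∀ x ∈ (β.append k N).dom, x < N → x ∈ β.dom := by
    rintro x (h | h) hx
    exacts [h, absurd hx (Nat.not_lt.2 h)]
  have hL : (β.append k N).IsLin := by
    refine ⟨?_, ?_, ?_⟩
    · rintro x hx (⟨h, -, h'⟩ | h | ⟨-, -, h⟩)
      · exact β.irrefl x (hmem x hx h) h'
      · omega
      · exact hlin.irrefl x trivial h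
    · rintro x hx y hy z hz (⟨h1, h2, h3⟩ | ⟨h1, h2⟩ | ⟨h1, h2, h3⟩)
        (⟨h4, h5, h6⟩ | ⟨h4, h5⟩ | ⟨h4, h5, h6⟩)
      · exact Or.inl ⟨h1, h5, β.trans x (hmem x hx h1) y (hmem y hy h2) z (hmem z hz h5) h3 h6⟩
      · exact Or.inr (Or.inl ⟨h1, h5⟩)
      · omega
      · omega
      · omega
      · exact Or.inr (Or.inl ⟨h1, h5⟩)
      · omega
      · omega
      · exact Or.inr (Or.inr ⟨h1, h5, hlin.trans x trivial y trivial z trivial h3 h6⟩)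
    · intro x hx y hy hxy
      change (_ ∨ _ ∨ _) ∨ (_ ∨ _ ∨ _)
      rcases lt_or_ge x N with h | h <;> rcases lt_or_ge y N with h' | h'
      · rcases β.total x (hmem x hx h) y (hmem y hy h') hxy with h'' | h'' <;> tauto
      · tauto
      · tauto
      · rcases hlin.total x trivial y trivial hxy with h'' | h'' <;> tauto
  classical
  refine isCopy_of_classes hL (fun x => if x < N then 0 else x % k) ?_ ?_ ?_ ?_
  · intro x
    split_ifs
    exacts [hk, Nat.mod_lt x hk]
  · intro x _ y _ h
    change _ ∨ _ ∨ _
    split_ifs at h with h1 h2 h2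
    · omega
    · exact Or.inr (Or.inl ⟨h1, not_lt.1 h2⟩)
    · omega
    · exact Or.inr (Or.inr ⟨not_lt.1 h1, not_lt.1 h2, Or.inl h⟩)
  · intro x _
    refine (Set.finite_lt_nat (x + N)).subset ?_
    rintro y ⟨_, h, h' | h' | ⟨h1, h2, h3⟩⟩
    · change y < x + N
      omega
    · change y < x + N
      omega
    · rw [if_neg (by omega), if_neg (by omega)] at h
      rcases h3 with h3 | h3
      · exact absurd h h3.ne
      · change y < x + N
        omega
  · intro i hi
    refine Set.infinite_of_injective_forall_mem (f := fun n => k * (n + N) + i) ?_ fun n => ?_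
    · intro a b h
      simpa [hk.ne'] using h
    · have : n + N ≤ k * (n + N) := Nat.le_mul_of_pos_left _ hk
      refine ⟨Or.inr ?_, ?_⟩
      · change N ≤ k * (n + N) + i
        omega
      · rw [if_neg (by omega), Nat.mul_add_mod, Nat.mod_eq_of_lt hi]

theorem FinLO.subDiag_append (β : FinLO) (k : ℕ) {N : ℕ} (hN : ∀ x ∈ β.dom, x < N) :
    β.SubDiag (β.append k N) := by
  refine ⟨Set.subset_union_left, fun x hx y hy => ?_⟩
  have h1 := hN x hx
  have h2 := hN y hy
  change _ ↔ _ ∨ _ ∨ _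
  simp [h1, h2, h1.not_ge, h2.not_ge]

theorem FinLO.Ext.subDiag_append {β γ : FinLO} (h : β.Ext γ) {k N : ℕ}
    {α : FinLO} (hα : α.SubDiag (β.append k N)) :
    α.SubDiag (γ.append k N) := by
  refine ⟨fun x hx => (hα.1 hx).imp (fun h' => h.1 h') id, fun x hx y hy => ?_⟩
  rw [hα.2 x hx y hy]
  change (_ ∨ _) ↔ (_ ∨ _)
  refine or_congr_left (and_congr_right fun h1 => and_congr_right fun h2 => h.2 x ?_ y ?_)
  · exact (hα.1 hx).resolve_right fun h' => absurd h1 (Nat.not_lt.2 h')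
  · exact (hα.1 hy).resolve_right fun h' => absurd h2 (Nat.not_lt.2 h')

/-! ### The order forced by a finite linear order -/

/-- The positive facts of `Γ` on `L` strictly and linearly order the output of `Γ` on `L`. -/
structure EnumOp.OutLin (Γ : EnumOp) (L : LinDiag) : Prop where
  asymm : ∀ x y, (x, y) ∈ Γ.posD L → x ∈ Γ.memD L → y ∈ Γ.memD L → (y, x) ∉ Γ.posD L
  trans : ∀ x ∈ Γ.memD L, ∀ y ∈ Γ.memD L, ∀ z ∈ Γ.memD L,
    (x, y) ∈ Γ.posD L → (y, z) ∈ Γ.posD L → (x, z) ∈ Γ.posD L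
  total : ∀ x ∈ Γ.memD L, ∀ y ∈ Γ.memD L, x ≠ y → (x, y) ∈ Γ.posD L ∨ (y, x) ∈ Γ.posD L

theorem EnumOp.OutCopy.outLin {Γ : EnumOp} {σ : Type} [LinearOrder σ] {L : LinDiag}
    (h : Γ.OutCopy σ L) : Γ.OutLin L := by
  obtain ⟨g, hg, hr, hlt, -⟩ := h
  refine ⟨?_, ?_, ?_⟩ <;> rw [hr]
  · rintro _ _ h ⟨i, rfl⟩ ⟨j, rfl⟩
    rw [hlt] at h ⊢
    exact h.asymm
  · rintro _ ⟨i, rfl⟩ _ ⟨j, rfl⟩ _ ⟨l, rfl⟩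
    simpa only [hlt] using lt_trans
  · rintro _ ⟨i, rfl⟩ _ ⟨j, rfl⟩ hij
    simpa only [hlt] using lt_or_gt_of_ne fun h => hij (congrArg g h)

/-- Some extension of `β` enumerates `x < y`. -/
def EnumOp.Pushes (Γ : EnumOp) (β : FinLO) (x y : ℕ) : Prop :=
  ∃ γ : FinLO, β.Ext γ ∧ (x, y) ∈ Γ.pos γ

section Forcing

variable {Γ : EnumOp} {k : ℕ}

theorem EnumOp.Pushes.asymm (hk : 0 < k)
    (hΓ : ∀ L : LinDiag, IsCopy (Lex (Fin k × ℕ)) L → Γ.OutLin L) {β : FinLO} {x y : ℕ}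
    (hx : x ∈ Γ.mem β) (hy : y ∈ Γ.mem β) (hne : x ≠ y) (h : Γ.Pushes β x y) :
    ¬ Γ.Pushes β y x := by
  rintro ⟨γ', hβγ', hγ'⟩
  obtain ⟨γ, hβγ, hγ⟩ := h
  obtain ⟨N, hN⟩ := (γ.dom ∪ γ'.dom).bddAbove
  have hlt : ∀ w ∈ γ.dom, w < N + 1 := fun w hw =>
    Nat.lt_succ_of_le (hN (Finset.mem_union_left _ hw))
  have hlt' : ∀ w ∈ γ'.dom, w < N + 1 := fun w hw =>
    Nat.lt_succ_of_le (hN (Finset.mem_union_right _ hw))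
  have hβ := β.subDiag_append k fun w hw => hlt w (hβγ.1 hw)
  have h₀ := hΓ _ (β.append_isCopy hk (N + 1))
  have h₁ := hΓ _ (γ.append_isCopy hk (N + 1))
  have h₂ := hΓ _ (γ'.append_isCopy hk (N + 1))
  have hsub := γ.subDiag_append k hlt
  have hsub' := γ'.subDiag_append k hlt'
  rcases h₀.total x ⟨β, hβ, hx⟩ y ⟨β, hβ, hy⟩ hne with ⟨δ, hδ, hxy⟩ | ⟨δ, hδ, hxy⟩
  · exact h₂.asymm x y ⟨δ, hβγ'.subDiag_append hδ, hxy⟩ ⟨β, hβγ'.subDiag hsub', hx⟩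
      ⟨β, hβγ'.subDiag hsub', hy⟩ ⟨γ', hsub', hγ'⟩
  · exact h₁.asymm y x ⟨δ, hβγ.subDiag_append hδ, hxy⟩ ⟨β, hβγ.subDiag hsub, hy⟩
      ⟨β, hβγ.subDiag hsub, hx⟩ ⟨γ, hsub, hγ⟩

theorem EnumOp.pushes_iff (hk : 0 < k)
    (hΓ : ∀ L : LinDiag, IsCopy (Lex (Fin k × ℕ)) L → Γ.OutLin L) {L : LinDiag} (hL : L.IsLin)
    (hΓL : Γ.OutLin L) {β : FinLO} (hβ : β.SubDiag L) {x y : ℕ}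
    (hx : x ∈ Γ.mem β) (hy : y ∈ Γ.mem β) (hne : x ≠ y) :
    Γ.Pushes β x y ↔ (x, y) ∈ Γ.posD L := by
  have key : ∀ x y, (x, y) ∈ Γ.posD L → Γ.Pushes β x y := by
    rintro x y ⟨α, hα, h⟩
    obtain ⟨γ, hγ, hαγ, hβγ⟩ := hα.exists_common hL hβ
    exact ⟨γ, hβγ, Γ.mono_pos hαγ h⟩
  refine ⟨fun h => ?_, key x y⟩
  refine (hΓL.total x ⟨β, hβ, hx⟩ y ⟨β, hβ, hy⟩ hne).resolve_right fun h' => ?_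
  exact h.asymm hk hΓ hx hy hne (key y x h')

theorem FinLO.exists_copy (β : FinLO) (hk : 0 < k) :
    ∃ L, IsCopy (Lex (Fin k × ℕ)) L ∧ β.SubDiag L := by
  obtain ⟨N, hN⟩ := β.dom.bddAbove
  exact ⟨_, β.append_isCopy hk (N + 1),
    β.subDiag_append k fun w hw => Nat.lt_succ_of_le (hN hw)⟩

theorem EnumOp.Pushes.ext (hk : 0 < k)
    (hΓ : ∀ L : LinDiag, IsCopy (Lex (Fin k × ℕ)) L → Γ.OutLin L) {β γ : FinLO} (h : β.Ext γ)
    {x y : ℕ} (hx : x ∈ Γ.mem β) (hy : y ∈ Γ.mem β) (hne : x ≠ y) (hp : Γ.Pushes β x y) :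
    Γ.Pushes γ x y := by
  obtain ⟨L, hL, hγ⟩ := γ.exists_copy hk
  rw [EnumOp.pushes_iff hk hΓ hL.isLin (hΓ L hL) hγ (Γ.mono_mem h hx) (Γ.mono_mem h hy) hne]
  rwa [EnumOp.pushes_iff hk hΓ hL.isLin (hΓ L hL) (h.subDiag hγ) hx hy hne] at hp

theorem EnumOp.Pushes.of_ext {β γ : FinLO} (h : β.Ext γ) {x y : ℕ} (hp : Γ.Pushes γ x y) :
    Γ.Pushes β x y := by
  obtain ⟨δ, hδ, hxy⟩ := hp
  exact ⟨δ, h.trans hδ, hxy⟩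

theorem EnumOp.Pushes.trans (hk : 0 < k)
    (hΓ : ∀ L : LinDiag, IsCopy (Lex (Fin k × ℕ)) L → Γ.OutLin L) {β : FinLO} {x y z : ℕ}
    (hx : x ∈ Γ.mem β) (hy : y ∈ Γ.mem β) (hz : z ∈ Γ.mem β) (hxy : x ≠ y) (hyz : y ≠ z)
    (hp : Γ.Pushes β x y) (hq : Γ.Pushes β y z) : Γ.Pushes β x z := by
  obtain ⟨L, hL, hβ⟩ := β.exists_copy hk
  have hΓL := hΓ L hL
  rw [EnumOp.pushes_iff hk hΓ hL.isLin hΓL hβ hx hy hxy] at hp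
  rw [EnumOp.pushes_iff hk hΓ hL.isLin hΓL hβ hy hz hyz] at hq
  obtain ⟨α, hα, h⟩ := hΓL.trans x ⟨β, hβ, hx⟩ y ⟨β, hβ, hy⟩ z ⟨β, hβ, hz⟩ hp hq
  obtain ⟨γ, hγ, hαγ, hβγ⟩ := hα.exists_common hL.isLin hβ
  exact ⟨γ, hβγ, Γ.mono_pos hαγ h⟩

end Forcing

/-! ### Order embeddings into `ω·t` -/

/-- Consecutive copies of `ω` inside `ω·t` lie in strictly increasing blocks. -/
theorem block_add_le {a t : ℕ} (h : ℕ → ℕ → Lex (Fin t × ℕ))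
    (hn : ∀ i < a, ∀ n m, n < m → h i n < h i m)
    (hi : ∀ i i', i < i' → i' < a → ∀ n m, h i n < h i' m) (j d N : ℕ) (hjd : j + d < a) :
    ((ofLex (h j N)).1 : ℕ) + d ≤ (ofLex (h (j + d) N)).1 := by
  induction d with
  | zero => simp
  | succ d ih =>
    have ih := ih (by omega)
    by_contra hcon
    have hbelow : ∀ n, h (j + d) n < h (j + (d + 1)) N := fun n => hi _ _ (by omega) hjd n N
    have hup : ∀ n, h (j + d) N ≤ h (j + d) (N + n) := by
      intro n
      rcases Nat.eq_zero_or_pos n with rfl | hpos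
      · simp
      · exact (hn _ (by omega) _ _ (by omega)).le
    have hfst : ∀ n, (ofLex (h (j + d) (N + n))).1 = (ofLex (h (j + (d + 1)) N)).1 := by
      intro n
      have h1 := Prod.Lex.monotone_fst _ _ (hup n)
      have h2 := Prod.Lex.monotone_fst _ _ (hbelow (N + n)).le
      rw [Fin.le_def] at h1 h2
      apply Fin.ext
      omega
    have hsnd : ∀ n, n ≤ (ofLex (h (j + d) (N + n))).2 := by
      intro n
      induction n with
      | zero => simp
      | succ n ihn =>
        have h1 := hn (j + d) (by omega) (N + n) (N + (n + 1)) (by omega)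
        rw [Prod.Lex.lt_iff, hfst, hfst] at h1
        have h2 := h1.resolve_left (lt_irrefl _)
        omega
    have h1 := hbelow (N + (ofLex (h (j + (d + 1)) N)).2)
    rw [Prod.Lex.lt_iff, hfst] at h1
    have h2 := h1.resolve_left (lt_irrefl _)
    exact absurd (hsnd (ofLex (h (j + (d + 1)) N)).2) (by omega)

theorem le_of_block_embedding {a t : ℕ} (h : ℕ → ℕ → Lex (Fin t × ℕ))
    (hn : ∀ i < a, ∀ n m, n < m → h i n < h i m)
    (hi : ∀ i i', i < i' → i' < a → ∀ n m, h i n < h i' m) : a ≤ t := by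
  rcases Nat.eq_zero_or_pos a with rfl | ha
  · exact Nat.zero_le t
  · have h1 := block_add_le h hn hi 0 (a - 1) 0 (by omega)
    have h2 := (ofLex (h (0 + (a - 1)) 0)).1.2
    omega

/-- A self-embedding of `ω·t` preserves the blocks. -/
theorem StrictMono.block_eq {t : ℕ} {h : Lex (Fin t × ℕ) → Lex (Fin t × ℕ)} (hh : StrictMono h)
    (j : Fin t) (n : ℕ) : (ofLex (h (toLex (j, n)))).1 = j := by
  have ht : 0 < t := j.pos
  let H : ℕ → ℕ → Lex (Fin t × ℕ) := fun i n =>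
    if hi : i < t then h (toLex (⟨i, hi⟩, n)) else h (toLex (⟨0, ht⟩, n))
  have hH : ∀ i (hi : i < t) n, H i n = h (toLex (⟨i, hi⟩, n)) := fun i hi n => dif_pos hi
  have h1 : ∀ i < t, ∀ n m, n < m → H i n < H i m := by
    intro i hi n m hnm
    rw [hH i hi, hH i hi]
    exact hh (Prod.Lex.toLex_lt_toLex.2 (Or.inr ⟨rfl, hnm⟩))
  have h2 : ∀ i i', i < i' → i' < t → ∀ n m, H i n < H i' m := by
    intro i i' hii' hi' n m
    rw [hH i (hii'.trans hi'), hH i' hi']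
    exact hh (Prod.Lex.toLex_lt_toLex.2 (Or.inl hii'))
  have h3 := block_add_le H h1 h2 0 j n (by omega)
  have h4 := block_add_le H h1 h2 j (t - 1 - j) n (by omega)
  have h5 := (ofLex (H (j + (t - 1 - j)) n)).1.2
  rw [Nat.zero_add] at h3
  rw [← hH j j.2 n]
  apply Fin.ext
  omega

/-! ### Disjointly supported outputs -/

theorem EnumOp.exists_interval {Γ : EnumOp} {k t : ℕ} (hk : 0 < k)
    (hΓ : ∀ L : LinDiag, IsCopy (Lex (Fin k × ℕ)) L → Γ.OutCopy (Lex (Fin t × ℕ)) L)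
    {g : Lex (Fin t × ℕ) → ℕ}
    (hr : Γ.memD (keyDiag (· % k) {x | 0 ≤ x}) = Set.range g)
    (hlt : ∀ a b, ((g a, g b) ∈ Γ.posD (keyDiag (· % k) {x | 0 ≤ x}) ↔ a < b)) (N : ℕ) :
    ∃ N', N < N' ∧ ∀ j : Fin t, ∃ p, N ≤ p ∧ p < N' ∧
      g (toLex (j, p)) ∈ Γ.mem (keyFin (· % k) (Finset.Ico N N')) := by
  obtain ⟨f, hf, hfr, hflt, -⟩ := hΓ _ (keyDiag_column_isCopy hk N)
  have hsub : ∀ α : FinLO, α.SubDiag (keyDiag (· % k) {x | N ≤ x}) →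
      α.SubDiag (keyDiag (· % k) {x | 0 ≤ x}) := fun α hα => ⟨fun x _ => Nat.zero_le x, hα.2⟩
  have hex : ∀ a, ∃ b, g b = f a := by
    intro a
    have : f a ∈ Γ.memD (keyDiag (· % k) {x | N ≤ x}) := hfr ▸ Set.mem_range_self a
    obtain ⟨α, hα, hmem⟩ := this
    have : f a ∈ Γ.memD (keyDiag (· % k) {x | 0 ≤ x}) := ⟨α, hsub α hα, hmem⟩
    rwa [hr] at this
  choose h hh using hex
  have hmono : StrictMono h := by
    intro a b hab
    obtain ⟨α, hα, hp⟩ := (hflt a b).2 hab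
    rw [← hlt, hh, hh]
    exact ⟨α, hsub α hα, hp⟩
  have hj : ∀ j : Fin t, ∃ p M, N ≤ p ∧ ∀ N', M ≤ N' → p < N' ∧
      g (toLex (j, p)) ∈ Γ.mem (keyFin (· % k) (Finset.Ico N N')) := by
    intro j
    have h1 := hmono.block_eq j N
    have h2 : toLex (j, N) ≤ h (toLex (j, N)) := hmono.le_apply
    have h3 : toLex (j, (ofLex (h (toLex (j, N)))).2) = h (toLex (j, N)) :=
      congrArg toLex (Prod.ext h1.symm rfl :
        (j, (ofLex (h (toLex (j, N)))).2) = ofLex (h (toLex (j, N))))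
    rw [← h3, Prod.Lex.toLex_le_toLex] at h2
    have h2 := (h2.resolve_left (lt_irrefl _)).2
    have : f (toLex (j, N)) ∈ Γ.memD (keyDiag (· % k) {x | N ≤ x}) := hfr ▸ Set.mem_range_self _
    obtain ⟨α, hα, hmem⟩ := this
    obtain ⟨M, hM⟩ := α.dom.bddAbove
    refine ⟨_, (ofLex (h (toLex (j, N)))).2 + 1 + (M + 1), h2, fun N' hN' => ⟨by omega, ?_⟩⟩
    rw [h3, hh]
    refine Γ.mono_mem ⟨fun x hx => ?_, hα.2⟩ hmem
    have h4 : N ≤ x := hα.1 hx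
    have h5 : x ≤ M := hM hx
    exact Finset.mem_Ico.2 ⟨h4, by omega⟩
  choose p M hp hM using hj
  refine ⟨N + 1 + Finset.univ.sup M, by omega, fun j => ⟨p j, hp j, hM j _ ?_⟩⟩
  exact (Finset.le_sup (Finset.mem_univ j)).trans (Nat.le_add_left _ _)

/-- A partition of the domain of the standard copy of `ω·k` into consecutive finite blocks `B n`
such that the outputs `z j n` depend only on `B n` and form a copy of `ω·t`. -/
structure EnumOp.Blocks (Γ : EnumOp) (k t : ℕ) where
  ν : ℕ → ℕ
  B : ℕ → Finset ℕ
  z : ℕ → ℕ → ℕ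
  mem_B : ∀ x n, x ∈ B n ↔ ν x = n
  nonempty : ∀ n, (B n).Nonempty
  lt_of_ν_lt : ∀ x y, ν x < ν y → x < y
  z_mem : ∀ j < t, ∀ n, z j n ∈ Γ.mem (keyFin (· % k) (B n))
  z_lt : ∀ j j' n m, j' < t → j < j' ∨ j = j' ∧ n < m →
    (z j n, z j' m) ∈ Γ.posD (keyDiag (· % k) {x | 0 ≤ x})
  z_inj : ∀ j < t, ∀ j' < t, ∀ n m, z j n = z j' m → j = j' ∧ n = m

theorem EnumOp.exists_blocks {Γ : EnumOp} {k t : ℕ} (hk : 0 < k)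
    (hΓ : ∀ L : LinDiag, IsCopy (Lex (Fin k × ℕ)) L → Γ.OutCopy (Lex (Fin t × ℕ)) L) :
    Nonempty (Γ.Blocks k t) := by
  obtain ⟨g, hg, hr, hlt, -⟩ := hΓ _ (keyDiag_column_isCopy hk 0)
  choose φ hφ p hp hpφ hmem using EnumOp.exists_interval hk hΓ hr hlt
  let b : ℕ → ℕ := fun n => φ^[n] 0
  have hb : ∀ n, b (n + 1) = φ (b n) := fun n => Function.iterate_succ_apply' φ n 0
  have hbm : StrictMono b := strictMono_nat_of_lt_succ fun n => by rw [hb]; exact hφ _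
  let ν : ℕ → ℕ := fun x => Nat.findGreatest (fun n => b n ≤ x) x
  have hν1 : ∀ x, b (ν x) ≤ x := fun x =>
    Nat.findGreatest_spec (P := fun n => b n ≤ x) (m := 0) (Nat.zero_le x) (Nat.zero_le x)
  have hν2 : ∀ x, x < b (ν x + 1) := by
    intro x
    by_contra hcon
    have h1 : ν x + 1 ≤ x := (hbm.le_apply).trans (not_lt.1 hcon)
    have h2 : ν x + 1 ≤ ν x := Nat.le_findGreatest (P := fun n => b n ≤ x) h1 (not_lt.1 hcon)
    omega
  have hB : ∀ x n, x ∈ Finset.Ico (b n) (b (n + 1)) ↔ ν x = n := by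
    intro x n
    rw [Finset.mem_Ico]
    constructor
    · rintro ⟨h1, h2⟩
      have h3 := hbm.lt_iff_lt.1 ((hν1 x).trans_lt h2)
      have h4 := hbm.lt_iff_lt.1 (h1.trans_lt (hν2 x))
      omega
    · rintro rfl
      exact ⟨hν1 x, hν2 x⟩
  let z : ℕ → ℕ → ℕ := fun j n => if h : j < t then g (toLex (⟨j, h⟩, p (b n) ⟨j, h⟩)) else 0
  have hz : ∀ j (h : j < t) n, z j n = g (toLex (⟨j, h⟩, p (b n) ⟨j, h⟩)) :=
    fun j h n => dif_pos h
  have hpb : ∀ j n m, n < m → p (b n) j < p (b m) j := fun j n m hnm =>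
    ((hpφ (b n) j).trans_le ((hb n).symm.le.trans (hbm.monotone hnm))).trans_le (hp (b m) j)
  refine ⟨⟨ν, fun n => Finset.Ico (b n) (b (n + 1)), z, hB,
    fun n => Finset.nonempty_Ico.2 (hbm (Nat.lt_succ_self n)), ?_, ?_, ?_, ?_⟩⟩
  · intro x y hxy
    exact (hν2 x).trans_le ((hbm.monotone hxy).trans (hν1 y))
  · intro j hj n
    rw [hz j hj, hb]
    exact hmem _ _
  · rintro j j' n m hj' (h | ⟨rfl, h⟩)
    · rw [hz j (h.trans hj'), hz j' hj', hlt, Prod.Lex.toLex_lt_toLex]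
      exact Or.inl h
    · rw [hz j hj', hz j hj', hlt, Prod.Lex.toLex_lt_toLex]
      exact Or.inr ⟨rfl, hpb _ _ _ h⟩
  · intro j hj j' hj' n m h
    rw [hz j hj, hz j' hj'] at h
    have h := toLex.injective (hg h)
    rw [Prod.mk.injEq, Fin.mk.injEq] at h
    obtain ⟨rfl, h⟩ := h
    refine ⟨rfl, ?_⟩
    rcases lt_trichotomy n m with h' | h' | h'
    · exact absurd h (hpb _ _ _ h').ne
    · exact h'
    · exact absurd h (hpb _ _ _ h').ne'

namespace EnumOp.Blocks

variable {Γ : EnumOp} {k t : ℕ} (b : Γ.Blocks k t)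

/-- The key putting the block `B n` entirely below the other blocks. -/
def mergedKey (n : ℕ) (x : ℕ) : ℕ ×ₗ ℕ := toLex (if b.ν x = n then 0 else 1, x % k)

/-- The block `B n` followed by the block `B m`. -/
def merged (n m : ℕ) : FinLO := keyFin (b.mergedKey n) (b.B n ∪ b.B m)

theorem keyAgree_of_block {A : Type} [LinearOrder A] {G : ℕ → A} {n : ℕ}
    (hG : ∀ x y, b.ν x = n → b.ν y = n → (G x < G y ↔ x % k < y % k)) :
    KeyAgree (· % k) G (b.B n) := by
  intro x hx y hy
  rw [b.mem_B] at hx hy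
  have h1 := hG x y hx hy
  have h2 := hG y x hy hx
  have h3 : G x = G y ↔ x % k = y % k := by
    rw [le_antisymm_iff, le_antisymm_iff, ← not_lt, ← not_lt, h1, h2, not_lt, not_lt]
  rw [keyRel, keyRel, h1, h3]

theorem keyAgree_merged {A : Type} [LinearOrder A] {G : ℕ → A} {n m : ℕ} (hnm : n ≠ m)
    (hn : KeyAgree (· % k) G (b.B n)) (hm : KeyAgree (· % k) G (b.B m))
    (h : ∀ x y, b.ν x = n → b.ν y = m → G x < G y) :
    KeyAgree (b.mergedKey n) G (b.B n ∪ b.B m) := by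
  have key : ∀ p, KeyAgree (b.mergedKey n) (· % k) (b.B p) := by
    intro p x hx y hy
    refine (b.keyAgree_of_block (fun x y hx hy => ?_) x hx y hy).symm
    simp [mergedKey, hx, hy, Prod.Lex.toLex_lt_toLex]
  intro x hx y hy
  rcases Finset.mem_union.1 hx with hx | hx <;> rcases Finset.mem_union.1 hy with hy | hy
  · exact (key n x hx y hy).trans (hn x hx y hy)
  · rw [b.mem_B] at hx hy
    refine iff_of_true (Or.inl ?_) (Or.inl (h x y hx hy))
    simp [mergedKey, hx, hy, hnm.symm, Prod.Lex.toLex_lt_toLex]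
  · rw [b.mem_B] at hx hy
    have h1 := h y x hy hx
    have h2 : b.mergedKey n y < b.mergedKey n x := by
      simp [mergedKey, hx, hy, hnm.symm, Prod.Lex.toLex_lt_toLex]
    refine iff_of_false ?_ ?_
    · rintro (h' | ⟨h', -⟩)
      exacts [h'.asymm h2, h2.ne' h']
    · rintro (h' | ⟨h', -⟩)
      exacts [h'.asymm h1, h1.ne' h']
  · exact (key m x hx y hy).trans (hm x hx y hy)

theorem z_mem_keyFin {A : Type} [LinearOrder A] {G : ℕ → A} {D : Finset ℕ} {n : ℕ}
    (hn : KeyAgree (· % k) G (b.B n)) (hD : b.B n ⊆ D) {j : ℕ} (hj : j < t) :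
    b.z j n ∈ Γ.mem (keyFin G D) :=
  Γ.mono_mem (hn.ext hD) (b.z_mem j hj n)

theorem keyAgree_mergedKey (n m : ℕ) : KeyAgree (· % k) (b.mergedKey n) (b.B m) :=
  b.keyAgree_of_block fun x y hx hy => by simp [mergedKey, hx, hy, Prod.Lex.toLex_lt_toLex]

theorem z_mem_merged_left (n m : ℕ) {j : ℕ} (hj : j < t) : b.z j n ∈ Γ.mem (b.merged n m) :=
  b.z_mem_keyFin (b.keyAgree_mergedKey n n) Finset.subset_union_left hj

theorem z_mem_merged_right (n m : ℕ) {j : ℕ} (hj : j < t) : b.z j m ∈ Γ.mem (b.merged n m) :=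
  b.z_mem_keyFin (b.keyAgree_mergedKey n m) Finset.subset_union_right hj

/-- The column order of two blocks already determines the order of their outputs. -/
theorem pushes_column (hk : 0 < k)
    (hΓ : ∀ L : LinDiag, IsCopy (Lex (Fin k × ℕ)) L → Γ.OutLin L)
    {j j' n m : ℕ} (hj' : j' < t) (h : j < j' ∨ j = j' ∧ n < m) {D : Finset ℕ}
    (hn : b.B n ⊆ D) (hm : b.B m ⊆ D) :
    Γ.Pushes (keyFin (· % k) D) (b.z j n) (b.z j' m) := by
  have hj : j < t := by omega
  have hc := keyDiag_column_isCopy hk 0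
  rw [EnumOp.pushes_iff hk hΓ hc.isLin (hΓ _ hc) ⟨fun x _ => Nat.zero_le x, fun _ _ _ _ => Iff.rfl⟩
    (b.z_mem_keyFin (fun _ _ _ _ => Iff.rfl) hn hj)
    (b.z_mem_keyFin (fun _ _ _ _ => Iff.rfl) hm hj')]
  · exact b.z_lt j j' n m hj' h
  · intro h'
    have := b.z_inj j hj j' hj' n m h'
    omega

theorem z_ne {j j' n m : ℕ} (hj : j < t) (hj' : j' < t) (h : j ≠ j' ∨ n ≠ m) :
    b.z j n ≠ b.z j' m := by
  intro h'
  have := b.z_inj j hj j' hj' n m h'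
  omega

/-- A family of blocks interpolating between the column order of two blocks and their
concatenation. -/
theorem exists_interpolation (hk : 0 < k)
    (hΓ : ∀ L : LinDiag, IsCopy (Lex (Fin k × ℕ)) L → Γ.OutLin L) {n m : ℕ} (hnm : n + k ≤ m) :
    ∃ (q : ℕ → ℕ) (β : FinLO), q 0 = n ∧ q k = m ∧ (∀ r s, r < s → s ≤ k → q r ≠ q s) ∧
      (b.merged n m).Ext β ∧ (∀ r ≤ k, ∀ j < t, b.z j (q r) ∈ Γ.mem β) ∧
      (∀ r < k, ∀ j < t, Γ.Pushes β (b.z j (q r)) (b.z j (q (r + 1)))) ∧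
      ∀ r < k, ∀ j j', j < j' → j' < t → Γ.Pushes β (b.z j (q (r + 1))) (b.z j' (q r)) := by
  let q : ℕ → ℕ := fun r => if r = k then m else n + r
  have hqk : q k = m := if_pos rfl
  have hq : ∀ r < k, q r = n + r := fun r hr => if_neg hr.ne
  have hqlt : ∀ r s, r < s → s ≤ k → q r < q s := by
    intro r s hrs hs
    rw [hq r (hrs.trans_le hs)]
    rcases hs.lt_or_eq with h | rfl
    · rw [hq s h]
      omega
    · rw [hqk]
      omega
  let ρ : ℕ → ℕ := fun x => if b.ν x = m then k else b.ν x - n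
  have hρ : ∀ r ≤ k, ∀ x, b.ν x = q r → ρ x = r := by
    intro r hr x hx
    rcases hr.lt_or_eq with h | rfl
    · rw [hq r h] at hx
      have : b.ν x ≠ m := by omega
      simp only [ρ, if_neg this]
      omega
    · exact if_pos (hx.trans hqk)
  let G : ℕ → ℕ := fun x => x % k * (k + 1) + ρ x * k
  have hG : ∀ r ≤ k, ∀ x, b.ν x = q r → G x = x % k * (k + 1) + r * k := fun r hr x hx => by
    simp only [G, hρ r hr x hx]
  have hmul : ∀ a a' : ℕ, a < a' → a * (k + 1) + k + 1 ≤ a' * (k + 1) := fun a a' h => by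
    have := Nat.mul_le_mul_right (k + 1) (Nat.succ_le_of_lt h)
    rwa [Nat.succ_mul] at this
  let D : Finset ℕ := (Finset.range (k + 1)).biUnion fun r => b.B (q r)
  have hD : ∀ r ≤ k, b.B (q r) ⊆ D := fun r hr =>
    Finset.subset_biUnion_of_mem (fun r => b.B (q r)) (Finset.mem_range.2 (Nat.lt_succ_of_le hr))
  have hblock : ∀ r ≤ k, KeyAgree (· % k) G (b.B (q r)) := by
    refine fun r hr => b.keyAgree_of_block fun x y hx hy => ?_
    rw [hG r hr x hx, hG r hr y hy]
    have h1 := hmul (x % k) (y % k)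
    have h2 : y % k ≤ x % k → y % k * (k + 1) ≤ x % k * (k + 1) := Nat.mul_le_mul_right _
    omega
  have hcross : ∀ r < k, ∀ x ∈ b.B (q r), ∀ y ∈ b.B (q (r + 1)),
      (keyRel (· % k) x y ↔ keyRel G x y) ∧ (keyRel (· % k) y x ↔ keyRel G y x) := by
    intro r hr x hx y hy
    rw [b.mem_B] at hx hy
    have hxy := b.lt_of_ν_lt x y (by rw [hx, hy]; exact hqlt r (r + 1) (Nat.lt_succ_self r) hr)
    simp only [keyRel]
    rw [hG r hr.le x hx, hG (r + 1) hr y hy, Nat.succ_mul]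
    have h1 := hmul (x % k) (y % k)
    have h2 := hmul (y % k) (x % k)
    rcases lt_trichotomy (x % k) (y % k) with h | h | h
    · specialize h1 h
      omega
    · rw [h]
      omega
    · specialize h2 h
      omega
  have hpair : ∀ r < k, KeyAgree (· % k) G (b.B (q r) ∪ b.B (q (r + 1))) := by
    intro r hr x hx y hy
    rcases Finset.mem_union.1 hx with hx | hx <;> rcases Finset.mem_union.1 hy with hy | hy
    · exact hblock r hr.le x hx y hy
    · exact (hcross r hr x hx y hy).1
    · exact (hcross r hr y hy x hx).2
    · exact hblock (r + 1) hr x hx y hy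
  have hext : ∀ r (hr : r < k), (keyFin (· % k) (b.B (q r) ∪ b.B (q (r + 1)))).Ext (keyFin G D) :=
    fun r hr => (hpair r hr).ext (Finset.union_subset (hD r hr.le) (hD (r + 1) hr))
  have hmem : ∀ r, ∀ j < t,
      b.z j (q r) ∈ Γ.mem (keyFin (· % k) (b.B (q r) ∪ b.B (q (r + 1)))) ∧
      b.z j (q (r + 1)) ∈ Γ.mem (keyFin (· % k) (b.B (q r) ∪ b.B (q (r + 1)))) := fun r j hj =>
    ⟨b.z_mem_keyFin (fun _ _ _ _ => Iff.rfl) Finset.subset_union_left hj,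
      b.z_mem_keyFin (fun _ _ _ _ => Iff.rfl) Finset.subset_union_right hj⟩
  have hq0 : q 0 = n := hq 0 hk
  refine ⟨q, keyFin G D, hq0, hqk, fun r s hrs hs => (hqlt r s hrs hs).ne, ?_, ?_, ?_, ?_⟩
  · refine (b.keyAgree_merged (G := G) (by omega) ?_ ?_ ?_).ext (Finset.union_subset ?_ ?_)
    · exact hq0 ▸ hblock 0 hk.le
    · exact hqk ▸ hblock k le_rfl
    · intro x y hx hy
      rw [hG 0 hk.le x (hx.trans hq0.symm), hG k le_rfl y (hy.trans hqk.symm)]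
      have := hmul (x % k) k (Nat.mod_lt x hk)
      rw [Nat.mul_succ k k] at this
      omega
    · exact hq0 ▸ hD 0 hk.le
    · exact hqk ▸ hD k le_rfl
  · exact fun r hr j hj => b.z_mem_keyFin (hblock r hr) (hD r hr) hj
  · intro r hr j hj
    have hlt := hqlt r (r + 1) (Nat.lt_succ_self r) hr
    exact (b.pushes_column hk hΓ hj (Or.inr ⟨rfl, hlt⟩) Finset.subset_union_left
      Finset.subset_union_right).ext hk hΓ (hext r hr) (hmem r j hj).1 (hmem r j hj).2
      (b.z_ne hj hj (Or.inr hlt.ne))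
  · intro r hr j j' hjj' hj'
    exact (b.pushes_column hk hΓ hj' (Or.inl hjj') Finset.subset_union_right
      Finset.subset_union_left).ext hk hΓ (hext r hr) (hmem r j (hjj'.trans hj')).2
      (hmem r j' hj').1 (b.z_ne (hjj'.trans hj') hj' (Or.inl hjj'.ne))

theorem pushes_merged_same (hk : 0 < k)
    (hΓ : ∀ L : LinDiag, IsCopy (Lex (Fin k × ℕ)) L → Γ.OutLin L) {n m : ℕ} (hnm : n + k ≤ m)
    {j : ℕ} (hj : j < t) : Γ.Pushes (b.merged n m) (b.z j n) (b.z j m) := by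
  obtain ⟨q, β, hq0, hqk, hne, hext, hmem, hup, -⟩ := b.exists_interpolation hk hΓ hnm
  have key : ∀ r < k, Γ.Pushes β (b.z j (q 0)) (b.z j (q (r + 1))) := by
    intro r
    induction r with
    | zero => exact fun h => hup 0 h j hj
    | succ r ih =>
      intro hr
      exact (ih (by omega)).trans hk hΓ (hmem 0 (by omega) j hj) (hmem (r + 1) (by omega) j hj)
        (hmem (r + 1 + 1) hr j hj) (b.z_ne hj hj (Or.inr (hne _ _ (by omega) (by omega))))
        (b.z_ne hj hj (Or.inr (hne _ _ (by omega) (by omega)))) (hup (r + 1) hr j hj)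
  have h := key (k - 1) (by omega)
  rw [Nat.sub_add_cancel hk, hq0, hqk] at h
  exact h.of_ext hext

theorem pushes_merged_shift (hk : 0 < k)
    (hΓ : ∀ L : LinDiag, IsCopy (Lex (Fin k × ℕ)) L → Γ.OutLin L) {n m : ℕ} (hnm : n + k ≤ m)
    {j : ℕ} (hj : j + k < t) : Γ.Pushes (b.merged n m) (b.z j m) (b.z (j + k) n) := by
  obtain ⟨q, β, hq0, hqk, hne, hext, hmem, -, hdown⟩ := b.exists_interpolation hk hΓ hnm
  have key : ∀ i < k, Γ.Pushes β (b.z j (q k)) (b.z (j + (i + 1)) (q (k - (i + 1)))) := by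
    intro i
    induction i with
    | zero =>
      intro h
      have := hdown (k - 1) (by omega) j (j + 1) (by omega) (by omega)
      rwa [Nat.sub_add_cancel hk] at this
    | succ i ih =>
      intro hi
      have h := hdown (k - (i + 1 + 1)) (by omega) (j + (i + 1)) (j + (i + 1 + 1))
        (by omega) (by omega)
      rw [show k - (i + 1 + 1) + 1 = k - (i + 1) by omega] at h
      exact (ih (by omega)).trans hk hΓ (hmem k le_rfl j (by omega))
        (hmem _ (by omega) _ (by omega)) (hmem _ (by omega) _ (by omega))
        (b.z_ne (by omega) (by omega) (Or.inl (by omega)))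
        (b.z_ne (by omega) (by omega) (Or.inl (by omega))) h
  have h := key (k - 1) (by omega)
  rw [Nat.sub_add_cancel hk, Nat.sub_self, hq0, hqk] at h
  exact h.of_ext hext

theorem finite_ν_le (n : ℕ) : {x | b.ν x ≤ n}.Finite := by
  obtain ⟨w, hw⟩ := b.nonempty (n + 1)
  rw [b.mem_B] at hw
  exact (Set.finite_lt_nat w).subset fun x hx =>
    b.lt_of_ν_lt x w (hw.symm ▸ Nat.lt_succ_of_le hx)

theorem infinite_ν_preimage {S : Set ℕ} (hS : S.Infinite) : (b.ν ⁻¹' S).Infinite := by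
  refine hS.preimage fun n _ => ?_
  obtain ⟨w, hw⟩ := b.nonempty n
  exact ⟨w, (b.mem_B w n).1 hw⟩

/-- Along a sparse sequence of blocks, the outputs of `B n` followed by `B m` are ordered in the
same way as `n` and `m`, even for `n > m`. -/
theorem exists_thinning (hk : 0 < k)
    (hΓ : ∀ L : LinDiag, IsCopy (Lex (Fin k × ℕ)) L → Γ.OutLin L)
    (hΓ' : ∀ L : LinDiag, IsCopy (Lex (Fin k × ℕ))ᵒᵈ L → Γ.OutCopy (Lex (Fin t × ℕ))ᵒᵈ L) :
    ∃ u : ℕ → ℕ, (∀ a a', a < a' → u a + k ≤ u a') ∧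
      ∀ a a', a < a' → ∀ j < t,
        Γ.Pushes (b.merged (u a') (u a)) (b.z j (u a')) (b.z j (u a)) := by
  let G : ℕ → ℕᵒᵈ ×ₗ ℕᵒᵈ ×ₗ ℕ := fun x =>
    toLex (OrderDual.toDual (b.ν x % k), toLex (OrderDual.toDual (b.ν x), x % k))
  have hlin := keyDiag_isLin G Set.univ
  have hcopy : IsCopy (Lex (Fin k × ℕ))ᵒᵈ (keyDiag G Set.univ) := by
    refine IsCopy.dual (isCopy_of_classes (c := fun x => b.ν x % k) ?_
      (fun x => Nat.mod_lt _ hk) ?_ ?_ ?_)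
    · exact ⟨hlin.irrefl, fun x hx y hy z hz h h' => hlin.trans z hz y hy x hx h' h,
        fun x hx y hy h => hlin.total y hy x hx h.symm⟩
    · exact fun x _ y _ h => Or.inl (Prod.Lex.toLex_lt_toLex.2 (Or.inl h))
    · refine fun x _ => (b.finite_ν_le (b.ν x)).subset ?_
      rintro y ⟨-, h, h'⟩
      have h' : G x ≤ G y := h'.elim le_of_lt fun h' => h'.1.le
      simp only [G, Prod.Lex.toLex_le_toLex, OrderDual.toDual_lt_toDual, h, lt_irrefl, false_or,
        true_and, EmbeddingLike.apply_eq_iff_eq] at h'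
      exact h'.elim le_of_lt fun h' => h'.1.symm.le
    · intro i hi
      have : {n | n % k = i}.Infinite := by
        refine Set.infinite_of_injective_forall_mem (f := fun n => k * n + i) ?_ fun n => ?_
        · exact fun a a' h => Nat.eq_of_mul_eq_mul_left hk (Nat.add_right_cancel h)
        · change (k * n + i) % k = i
          rw [Nat.mul_add_mod, Nat.mod_eq_of_lt hi]
      simpa [LinDiag.swap, keyDiag, Set.preimage] using b.infinite_ν_preimage this
  obtain hout := hΓ' _ hcopy
  have hlinout := hout.outLin
  obtain ⟨g, hg, hr, hlt, -⟩ := hout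
  have hblock : ∀ n, KeyAgree (· % k) G (b.B n) := fun n =>
    b.keyAgree_of_block fun x y hx hy => by simp [G, hx, hy, Prod.Lex.toLex_lt_toLex]
  have hP : ∀ (n : ℕ) (j : Fin t), ∃ p : Lex (Fin t × ℕ),
      g (OrderDual.toDual p) = b.z j (k * n) := by
    intro n j
    have : b.z j (k * n) ∈ Γ.memD (keyDiag G Set.univ) :=
      ⟨_, (hblock (k * n)).subDiag (Set.subset_univ _),
        b.z_mem_keyFin (fun _ _ _ _ => Iff.rfl) subset_rfl j.2⟩
    rw [hr] at this
    exact this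
  choose P hP using hP
  have hwqo : WellQuasiOrdered fun f f' : Fin t → Lex (Fin t × ℕ) => f ≤ f' := wellQuasiOrdered_le
  obtain ⟨φ, hφ⟩ := hwqo.exists_monotone_subseq P
  have hu : ∀ a a', a < a' → k * φ a + k ≤ k * φ a' := fun a a' h => by
    rw [← Nat.mul_succ]
    exact Nat.mul_le_mul_left k (φ.lt_iff_lt.2 h)
  refine ⟨fun a => k * φ a, hu, fun a a' h j hj => ?_⟩
  have h1 := hu a a' h
  have hne := b.z_ne hj hj (Or.inr (show k * φ a' ≠ k * φ a by omega))
  have hsub : (b.merged (k * φ a') (k * φ a)).SubDiag (keyDiag G Set.univ) := by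
    refine (b.keyAgree_merged (by omega) (hblock _) (hblock _) fun x y hx hy => ?_).subDiag
      (Set.subset_univ _)
    refine Prod.Lex.toLex_lt_toLex.2 (Or.inr ⟨?_, Prod.Lex.toLex_lt_toLex.2 (Or.inl ?_)⟩)
    · simp [hx, hy]
    · rw [OrderDual.toDual_lt_toDual, hx, hy]
      omega
  rw [EnumOp.pushes_iff hk hΓ hlin hlinout hsub (b.z_mem_merged_left _ _ hj)
    (b.z_mem_merged_right _ _ hj) hne]
  have h2 := hφ a a' h.le ⟨j, hj⟩
  rw [← hP (φ a') ⟨j, hj⟩, ← hP (φ a) ⟨j, hj⟩] at hne ⊢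
  rw [hlt]
  exact OrderDual.toDual_lt_toDual.2 (h2.lt_of_ne fun h => hne (by rw [h]))

/-- The final arrangement: blocks along a thinned sequence, sorted into `k` classes. -/
theorem dvd (b : Γ.Blocks k t) (hk : 0 < k)
    (hΓ : ∀ L : LinDiag, IsCopy (Lex (Fin k × ℕ)) L → Γ.OutCopy (Lex (Fin t × ℕ)) L)
    (hΓ' : ∀ L : LinDiag, IsCopy (Lex (Fin k × ℕ))ᵒᵈ L → Γ.OutCopy (Lex (Fin t × ℕ))ᵒᵈ L) :
    k ∣ t := by
  have hΓl : ∀ L : LinDiag, IsCopy (Lex (Fin k × ℕ)) L → Γ.OutLin L := fun L hL => (hΓ L hL).outLin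
  obtain ⟨u, hu, hrev⟩ := b.exists_thinning hk hΓl hΓ'
  have hum : StrictMono u := fun a a' h => (Nat.lt_add_of_pos_right hk).trans_le (hu a a' h)
  let v : ℕ → ℕ := Function.invFun u
  have hv : ∀ a, v (u a) = a := Function.leftInverse_invFun hum.injective
  let c : ℕ → ℕ := fun x => v (b.ν x) % k
  let G : ℕ → ℕ ×ₗ ℕ ×ₗ ℕ := fun x => toLex (c x, toLex (b.ν x, x % k))
  let S : Set ℕ := b.ν ⁻¹' Set.range u
  have hcopy : IsCopy (Lex (Fin k × ℕ)) (keyDiag G S) := by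
    refine isCopy_of_classes (keyDiag_isLin G S) c (fun x => Nat.mod_lt _ hk)
      (fun x _ y _ h => Or.inl (Prod.Lex.toLex_lt_toLex.2 (Or.inl h))) ?_ ?_
    · refine fun x _ => (b.finite_ν_le (b.ν x)).subset ?_
      rintro y ⟨-, h, h'⟩
      have h' : G y ≤ G x := h'.elim le_of_lt fun h' => h'.1.le
      simp only [G, Prod.Lex.toLex_le_toLex, h, lt_irrefl, false_or, true_and] at h'
      exact h'.elim le_of_lt fun h' => h'.1.le
    · intro i hi
      have hinf : (Set.range fun n => u (k * n + i)).Infinite :=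
        Set.infinite_range_of_injective fun a a' h =>
          Nat.eq_of_mul_eq_mul_left hk (Nat.add_right_cancel (hum.injective h))
      refine (b.infinite_ν_preimage hinf).mono ?_
      rintro x ⟨n, hn⟩
      refine ⟨⟨_, hn⟩, ?_⟩
      simp only [c, ← hn, hv, Nat.mul_add_mod, Nat.mod_eq_of_lt hi]
  have hout := hΓ _ hcopy
  have hlinout := hout.outLin
  obtain ⟨g, hg, hr, hlt, -⟩ := hout
  have hblock : ∀ n, KeyAgree (· % k) G (b.B n) := fun n =>
    b.keyAgree_of_block fun x y hx hy => by simp [G, c, hx, hy, Prod.Lex.toLex_lt_toLex]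
  have hBS : ∀ a, ↑(b.B (u a)) ⊆ S := fun a x hx => ⟨a, ((b.mem_B x (u a)).1 hx).symm⟩
  have hP : ∀ (j : Fin t) (a : ℕ), ∃ p : Lex (Fin t × ℕ), g p = b.z j (u a) := by
    intro j a
    have : b.z j (u a) ∈ Γ.memD (keyDiag G S) :=
      ⟨_, (hblock (u a)).subDiag (hBS a), b.z_mem_keyFin (fun _ _ _ _ => Iff.rfl) subset_rfl j.2⟩
    rwa [hr] at this
  choose P hP using hP
  have hmerged : ∀ (j j' : Fin t) (a a' : ℕ), (a % k < a' % k ∨ a % k = a' % k ∧ a < a') →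
      (Γ.Pushes (b.merged (u a) (u a')) (b.z j (u a)) (b.z j' (u a')) → P j a < P j' a') ∧
      (Γ.Pushes (b.merged (u a) (u a')) (b.z j' (u a')) (b.z j (u a)) → P j' a' < P j a) := by
    intro j j' a a' haa'
    have hne : u a ≠ u a' := fun h => by
      have := hum.injective h
      subst this
      omega
    have hsub : (b.merged (u a) (u a')).SubDiag (keyDiag G S) := by
      refine (b.keyAgree_merged hne (hblock _) (hblock _) fun x y hx hy => ?_).subDiag ?_
      · simp only [G, c, hx, hy, hv, Prod.Lex.toLex_lt_toLex]
        have := @hum a a'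
        omega
      · rw [Finset.coe_union]
        exact Set.union_subset (hBS a) (hBS a')
    have h1 := b.z_mem_merged_left (u a) (u a') j.2
    have h2 := b.z_mem_merged_right (u a) (u a') j'.2
    have h3 := b.z_ne j.2 j'.2 (Or.inr hne)
    rw [EnumOp.pushes_iff hk hΓl (keyDiag_isLin G S) hlinout hsub h1 h2 h3,
      EnumOp.pushes_iff hk hΓl (keyDiag_isLin G S) hlinout hsub h2 h1 h3.symm,
      ← hP, ← hP, hlt, hlt]
    exact ⟨id, id⟩
  have hsame : ∀ (j : Fin t) (a a' : ℕ), (a % k < a' % k ∨ a % k = a' % k ∧ a < a') →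
      P j a < P j a' := by
    intro j a a' haa'
    refine (hmerged j j a a' haa').1 ?_
    rcases lt_trichotomy a a' with h | rfl | h
    · exact b.pushes_merged_same hk hΓl (hu a a' h) j.2
    · omega
    · exact hrev a' a h j j.2
  have hinner : ∀ (j j' : Fin t) (a : ℕ), j < j' → P j a < P j' a := by
    intro j j' a hjj'
    rw [← hlt, hP, hP]
    refine (EnumOp.pushes_iff hk hΓl (keyDiag_isLin G S) hlinout
      ((hblock (u a)).subDiag (hBS a))
      (b.z_mem_keyFin (fun _ _ _ _ => Iff.rfl) subset_rfl j.2)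
      (b.z_mem_keyFin (fun _ _ _ _ => Iff.rfl) subset_rfl j'.2)
      (b.z_ne j.2 j'.2 (Or.inl (Fin.val_ne_of_ne hjj'.ne)))).1 ?_
    exact b.pushes_column hk hΓl j'.2 (Or.inl hjj') subset_rfl subset_rfl
  have hle : ∀ (j j' : Fin t) (a : ℕ), j ≤ j' → P j a ≤ P j' a := by
    intro j j' a h
    rcases h.eq_or_lt with rfl | h
    exacts [le_rfl, (hinner j j' a h).le]
  have hshift : ∀ (j j' : Fin t) (a a' : ℕ), (j : ℕ) + k ≤ j' → P j a < P j' a' := by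
    intro j j' a a' hjj'
    have hjt : (j : ℕ) + k < t := hjj'.trans_lt j'.2
    have hdown : ∀ a a', (a' % k < a % k ∨ a' % k = a % k ∧ a' < a) → a' < a →
        P j a < P j' a' := fun a a' h h' =>
      ((hmerged ⟨j + k, hjt⟩ j a' a h).2 (b.pushes_merged_shift hk hΓl (hu a' a h') hjt)).trans_le
        (hle _ _ _ hjj')
    by_cases h1 : a % k < a' % k ∨ a % k = a' % k ∧ a ≤ a'
    · have h2 : P j a ≤ P j a' := by
        rcases eq_or_ne a a' with rfl | hne
        · exact le_rfl
        · exact (hsame j a a' (by omega)).le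
      exact h2.trans_lt (hinner j j' a' (Fin.lt_def.2 (by omega)))
    · by_cases h2 : a' < a
      · exact hdown a a' (by omega) h2
      · have h3 : (a + k * (a' + 1)) % k = a % k := Nat.add_mul_mod_self_left _ _ _
        have h4 : a' + 1 ≤ k * (a' + 1) := Nat.le_mul_of_pos_left _ hk
        exact (hsame j a (a + k * (a' + 1)) (by omega)).trans (hdown _ a' (by omega) (by omega))
  by_contra hdvd
  have hmod : 0 < t % k := Nat.pos_of_ne_zero fun h => hdvd (Nat.dvd_of_mod_eq_zero h)
  have hdm := Nat.div_add_mod t k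
  have hjlt : ∀ i, i < k * (t / k + 1) → k * (i / k) < t := by
    intro i hi
    have h1 := Nat.mul_le_mul_left k (Nat.le_of_lt_succ (Nat.div_lt_of_lt_mul hi))
    omega
  have ht : 0 < t := by
    have := Nat.mod_le t k
    omega
  let H : ℕ → ℕ → Lex (Fin t × ℕ) := fun i n =>
    if h : k * (i / k) < t then P ⟨k * (i / k), h⟩ (k * n + i % k) else P ⟨0, ht⟩ 0
  have hH : ∀ i (h : k * (i / k) < t) n, H i n = P ⟨k * (i / k), h⟩ (k * n + i % k) :=
    fun i h n => dif_pos h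
  have hmodk : ∀ n i, (k * n + i % k) % k = i % k := fun n i => by
    rw [Nat.mul_add_mod, Nat.mod_mod]
  have hcount := le_of_block_embedding (a := k * (t / k + 1)) H ?_ ?_
  · rw [Nat.mul_succ] at hcount
    have := Nat.mod_lt t hk
    omega
  · intro i hi n m hnm
    rw [hH i (hjlt i hi), hH i (hjlt i hi)]
    refine hsame _ _ _ (Or.inr ⟨by rw [hmodk, hmodk], ?_⟩)
    exact Nat.add_lt_add_right (Nat.mul_lt_mul_of_pos_left hnm hk) _
  · intro i i' hii' hi' n m
    rw [hH i (hjlt i (hii'.trans hi')), hH i' (hjlt i' hi')]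
    rcases (Nat.div_le_div_right (c := k) hii'.le).eq_or_lt with h | h
    · simp only [h]
      refine hsame _ _ _ (Or.inl ?_)
      rw [hmodk, hmodk]
      have h1 := Nat.div_add_mod i k
      have h2 := Nat.div_add_mod i' k
      rw [h] at h1
      omega
    · refine hshift _ _ _ _ ?_
      change k * (i / k) + k ≤ k * (i' / k)
      rw [← Nat.mul_succ]
      exact Nat.mul_le_mul_left k h

end EnumOp.Blocks

/-! ### Replicating a linear order -/

/-- The order on `m` consecutive copies of a relation, with `m * a + r` the copy of `a` numbered
`r`. -/
def replicateRel (R : ℕ → ℕ → Prop) (m x y : ℕ) : Prop :=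
  x % m < y % m ∨ x % m = y % m ∧ R (x / m) (y / m)

/-- The operator sending a linear order to the sum of `m` copies of it. -/
def EnumOp.replicate (m : ℕ) : EnumOp where
  mem α := {x | x / m ∈ α.dom}
  pos α := {p | p.1 / m ∈ α.dom ∧ p.2 / m ∈ α.dom ∧ replicateRel α.rel m p.1 p.2}
  neg α := {p | p.1 / m ∈ α.dom ∧ p.2 / m ∈ α.dom ∧ ¬ replicateRel α.rel m p.1 p.2}
  mono_mem h _ hx := h.1 hx
  mono_pos h p hp := ⟨h.1 hp.1, h.1 hp.2.1, by
    have := hp.2.2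
    rwa [replicateRel, h.2 _ hp.1 _ hp.2.1] at this⟩
  mono_neg h p hp := ⟨h.1 hp.1, h.1 hp.2.1, by
    have := hp.2.2
    rwa [replicateRel, h.2 _ hp.1 _ hp.2.1] at this⟩

theorem EnumOp.replicate_outCopy {m : ℕ} (hm : 0 < m) {τ σ : Type} [LinearOrder τ] [LinearOrder σ]
    {L : LinDiag} (hL : IsCopy τ L) (φ : σ → ℕ) (ψ : σ → τ) (hφ : ∀ a, φ a < m)
    (hsurj : ∀ r < m, ∀ c, ∃ a, φ a = r ∧ ψ a = c)
    (hφψ : ∀ a b, a < b ↔ φ a < φ b ∨ φ a = φ b ∧ ψ a < ψ b) :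
    (EnumOp.replicate m).OutCopy σ L := by
  have hlin := hL.isLin
  obtain ⟨f, hf, hr, hlt⟩ := hL
  let g : σ → ℕ := fun a => m * f (ψ a) + φ a
  have hdiv : ∀ a, g a / m = f (ψ a) := fun a => by
    rw [Nat.mul_add_div hm, Nat.div_eq_of_lt (hφ a), Nat.add_zero]
  have hmod : ∀ a, g a % m = φ a := fun a => by
    rw [Nat.mul_add_mod, Nat.mod_eq_of_lt (hφ a)]
  have hrel : ∀ a b, replicateRel L.rel m (g a) (g b) ↔ a < b := fun a b => by
    rw [replicateRel, hmod, hmod, hdiv, hdiv, hlt, hφψ]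
  have hdom : ∀ c, f c ∈ L.dom := fun c => hr ▸ Set.mem_range_self c
  have hsub : ∀ a b, ∃ α : FinLO, α.SubDiag L ∧ g a / m ∈ α.dom ∧ g b / m ∈ α.dom := by
    intro a b
    have hD : ↑({f (ψ a), f (ψ b)} : Finset ℕ) ⊆ L.dom := by
      simp [Set.insert_subset_iff, hdom]
    refine ⟨_, L.restrict_subDiag hlin hD, ?_, ?_⟩ <;> simp [LinDiag.restrict, hdiv]
  have hiff : ∀ a b, ∀ α : FinLO, α.SubDiag L → g a / m ∈ α.dom → g b / m ∈ α.dom →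
      (replicateRel α.rel m (g a) (g b) ↔ a < b) := by
    intro a b α hα ha hb
    rw [← hrel, replicateRel, replicateRel, hα.2 _ ha _ hb]
  refine ⟨g, fun a b h => ?_, ?_, fun a b => ⟨?_, fun h => ?_⟩, fun a b => ⟨?_, fun h => ?_⟩⟩
  · have h1 : φ a = φ b := by rw [← hmod, h, hmod]
    have h2 : ψ a = ψ b := hf (by rw [← hdiv, h, hdiv])
    rcases lt_trichotomy a b with h3 | h3 | h3
    · simp [hφψ, h1, h2] at h3
    · exact h3
    · simp [hφψ, h1, h2] at h3
  · ext x
    constructor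
    · rintro ⟨α, hα, hx⟩
      have h1 : x / m ∈ Set.range f := hr ▸ hα.1 hx
      obtain ⟨c, hc⟩ := h1
      obtain ⟨a, h2, h3⟩ := hsurj (x % m) (Nat.mod_lt x hm) c
      exact ⟨a, by rw [← Nat.div_add_mod x m, ← h2, ← hc, ← h3]⟩
    · rintro ⟨a, rfl⟩
      obtain ⟨α, hα, h1, -⟩ := hsub a a
      exact ⟨α, hα, h1⟩
  · rintro ⟨α, hα, ha, hb, h⟩
    exact (hiff a b α hα ha hb).1 h
  · obtain ⟨α, hα, ha, hb⟩ := hsub a b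
    exact ⟨α, hα, ha, hb, (hiff a b α hα ha hb).2 h⟩
  · rintro ⟨α, hα, ha, hb, h⟩
    rwa [hiff a b α hα ha hb] at h
  · obtain ⟨α, hα, ha, hb⟩ := hsub a b
    exact ⟨α, hα, ha, hb, by rwa [hiff a b α hα ha hb]⟩

theorem EnumOp.replicate_embeds {k m : ℕ} (hk : 0 < k) (hm : 0 < m) :
    (EnumOp.replicate m).Embeds (Lex (Fin k × ℕ)) (Lex (Fin k × ℕ))ᵒᵈ
      (Lex (Fin (k * m) × ℕ)) (Lex (Fin (k * m) × ℕ))ᵒᵈ := by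
  let φ : Lex (Fin (k * m) × ℕ) → ℕ := fun a => ((ofLex a).1 : ℕ) / k
  let ψ : Lex (Fin (k * m) × ℕ) → Lex (Fin k × ℕ) := fun a =>
    toLex (⟨((ofLex a).1 : ℕ) % k, Nat.mod_lt _ hk⟩, (ofLex a).2)
  have hφ : ∀ a, φ a < m := fun a => Nat.div_lt_of_lt_mul (ofLex a).1.2
  have hsurj : ∀ r < m, ∀ c, ∃ a, φ a = r ∧ ψ a = c := by
    intro r hr c
    have hc := (ofLex c).1.2
    have hlt : k * r + (ofLex c).1 < k * m := by
      have := Nat.mul_le_mul_left k (Nat.succ_le_of_lt hr)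
      rw [Nat.mul_succ] at this
      omega
    refine ⟨toLex (⟨k * r + (ofLex c).1, hlt⟩, (ofLex c).2), ?_, ?_⟩
    · change (k * r + (ofLex c).1) / k = r
      rw [Nat.mul_add_div hk, Nat.div_eq_of_lt hc, Nat.add_zero]
    · refine congrArg toLex (Prod.ext (Fin.ext ?_) rfl :
        ((⟨(k * r + (ofLex c).1) % k, _⟩, (ofLex c).2) : Fin k × ℕ) = ofLex c)
      change (k * r + (ofLex c).1) % k = _
      rw [Nat.mul_add_mod, Nat.mod_eq_of_lt hc]
  have hφψ : ∀ a b, a < b ↔ φ a < φ b ∨ φ a = φ b ∧ ψ a < ψ b := by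
    intro a b
    simp only [φ, ψ, ofLex_toLex, Prod.Lex.lt_iff, Fin.lt_def, Fin.ext_iff]
    have h1 := Nat.div_add_mod (ofLex a).1 k
    have h2 := Nat.div_add_mod (ofLex b).1 k
    have h3 := Nat.mod_lt (ofLex a).1 hk
    have h4 := Nat.mod_lt (ofLex b).1 hk
    rcases lt_trichotomy (((ofLex a).1 : ℕ) / k) ((ofLex b).1 / k) with h | h | h
    · have h5 := Nat.mul_le_mul_left k (Nat.succ_le_of_lt h)
      rw [Nat.mul_succ] at h5
      omega
    · rw [h] at h1 ⊢
      omega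
    · have h5 := Nat.mul_le_mul_left k (Nat.succ_le_of_lt h)
      rw [Nat.mul_succ] at h5
      omega
  refine ⟨fun L hL => EnumOp.replicate_outCopy hm hL φ ψ hφ hsurj hφψ, fun L hL =>
    EnumOp.replicate_outCopy hm hL (fun a => m - 1 - φ (OrderDual.ofDual a))
      (fun a => OrderDual.toDual (ψ (OrderDual.ofDual a))) (fun a => by omega) ?_ ?_⟩
  · intro r hr c
    obtain ⟨a, h1, h2⟩ := hsurj (m - 1 - r) (by omega) (OrderDual.ofDual c)
    refine ⟨OrderDual.toDual a, ?_, congrArg OrderDual.toDual h2⟩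
    rw [OrderDual.ofDual_toDual, h1]
    omega
  · intro a b
    rw [← OrderDual.ofDual_lt_ofDual, hφψ, OrderDual.toDual_lt_toDual]
    have h1 := hφ (OrderDual.ofDual a)
    have h2 := hφ (OrderDual.ofDual b)
    refine or_congr ?_ (and_congr_left' ?_) <;> omega

/-- main theorem: for non-zero `k` and `t`,
`k ∣ t` iff `{ω·k, ω*·k} ≤_c {ω·t, ω*·t}`. -/
theorem divides_iff_embeds (k t : ℕ) (hk : k ≠ 0) (ht : t ≠ 0) :
    k ∣ t ↔ PairLE (Lex (Fin k × ℕ)) ((Lex (Fin k × ℕ))ᵒᵈ)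
      (Lex (Fin t × ℕ)) ((Lex (Fin t × ℕ))ᵒᵈ) := by
  have hk := Nat.pos_of_ne_zero hk
  constructor
  · rintro ⟨m, rfl⟩
    exact ⟨_, EnumOp.replicate_embeds hk (Nat.pos_of_ne_zero (right_ne_zero_of_mul ht))⟩
  · rintro ⟨Γ, hΓ, hΓ'⟩
    obtain ⟨b⟩ := EnumOp.exists_blocks hk hΓ
    exact b.dvd hk hΓ hΓ'
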